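/- Let C be an abelian category with enough projectives which is naively Gorenstein (every object has finite G-dimension). Then (gpC, pC^(−)) is a hereditary cotorsion pair: gpC = ⊥₁(pC^(−)) and pC^(−) = (gpC)^⊥₁, Ext^j_C(G,K)=0 for all G∈gpC, K∈pC^(−), j>0, and every object admits a special right gpC-approximation. -/

import Mathlib

open CategoryTheory CategoryTheory.Limits

universe w w' v v' u u'

section Defs

variable {C : Type u} [Category.{v} C] [Abelian C]

/-- `f`, `g` form a short exact sequence `0 → X → Y → Z → 0`. -/
def IsSES {X Y Z : C} (f : X ⟶ Y) (g : Y ⟶ Z) : Prop :=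
  ∃ w : f ≫ g = 0, (ShortComplex.mk f g w).ShortExact

/-- Vanishing of the Yoneda Ext¹ group: every short exact sequence
`0 → P → E → Z → 0` splits. -/
def YonedaExt1Zero (Z P : C) : Prop :=
  ∀ (E : C) (i : P ⟶ E) (p : E ⟶ Z), IsSES i p → ∃ s : Z ⟶ E, s ≫ p = 𝟙 Z

/-- A totally acyclic complex of projectives: an exact complex of projective
objects which stays exact after applying `Hom(-, Q)` for every projective `Q`. -/
structure IsTotallyAcyclic (P : ChainComplex C ℤ) : Prop where
  projective : ∀ i, Projective (P.X i)
  acyclic : ∀ i, P.ExactAt i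
  homExact : ∀ (Q : C), Projective Q → ∀ (i : ℤ) (f : P.X i ⟶ Q),
    P.d (i + 1) i ≫ f = 0 → ∃ g : P.X (i - 1) ⟶ Q, P.d i (i - 1) ≫ g = f

/-- An object is Gorenstein projective if it is (isomorphic to) a syzygy of a
totally acyclic complex of projectives. -/
def IsGorensteinProjective (X : C) : Prop :=
  ∃ P : ChainComplex C ℤ, IsTotallyAcyclic P ∧ Nonempty (X ≅ cokernel (P.d 1 0))

/-- `X` admits a resolution of length at most `n` by objects satisfying `S`. -/
inductive HasResDimLE (S : C → Prop) : C → ℕ → Prop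
  | of_mem {X : C} (hX : S X) (n : ℕ) : HasResDimLE S X n
  | step {X K G : C} (n : ℕ) (f : K ⟶ G) (g : G ⟶ X)
      (hses : IsSES f g) (hG : S G) (hK : HasResDimLE S K n) :
      HasResDimLE S X (n + 1)

/-- The G-dimension: the minimal length of a Gorenstein projective resolution. -/
noncomputable def gDim (X : C) : ℕ∞ :=
  sInf {n : ℕ∞ | ∃ m : ℕ, n = (m : ℕ∞) ∧ HasResDimLE IsGorensteinProjective X m}

variable [HasExt.{w} C]

/-- The projective dimension: the minimal `m` such that `Ext^j(X, -)` vanishes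
for all `j > m`. -/
noncomputable def projDim (X : C) : ℕ∞ :=
  sInf {n : ℕ∞ | ∃ m : ℕ, n = (m : ℕ∞) ∧
    ∀ (Y : C) (j : ℕ), m < j → Subsingleton (Abelian.Ext X Y j)}

/-- The injective dimension: the minimal `m` such that `Ext^j(-, X)` vanishes
for all `j > m`. -/
noncomputable def injDim (X : C) : ℕ∞ :=
  sInf {n : ℕ∞ | ∃ m : ℕ, n = (m : ℕ∞) ∧
    ∀ (Y : C) (j : ℕ), m < j → Subsingleton (Abelian.Ext Y X j)}

end Defs

section Lemmas

open Abelian ZeroObject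

section ShortExact

variable {C : Type u} [Category.{v} C] [Abelian C]

lemma isSES_of_desc {X Y Z : C} (f : X ⟶ Y) (g : Y ⟶ Z) [Mono f] [Epi g] (w : f ≫ g = 0)
    (h : ∀ (T : C) (k : Y ⟶ T), f ≫ k = 0 → ∃ l : Z ⟶ T, g ≫ l = k) : IsSES f g :=
  ⟨w, { exact := ShortComplex.exact_of_g_is_cokernel _
          (CokernelCofork.IsColimit.ofπ' g w fun k hk => ⟨_, (h _ k hk).choose_spec⟩)
        mono_f := ‹_›
        epi_g := ‹_› }⟩

lemma IsSES.mono {X Y Z : C} {f : X ⟶ Y} {g : Y ⟶ Z} (h : IsSES f g) : Mono f :=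
  h.choose_spec.mono_f

lemma IsSES.epi {X Y Z : C} {f : X ⟶ Y} {g : Y ⟶ Z} (h : IsSES f g) : Epi g :=
  h.choose_spec.epi_g

lemma IsSES.exists_desc {X Y Z : C} {f : X ⟶ Y} {g : Y ⟶ Z} (h : IsSES f g) {T : C}
    (k : Y ⟶ T) (hk : f ≫ k = 0) : ∃ l : Z ⟶ T, g ≫ l = k := by
  obtain ⟨w, h⟩ := h
  have := h.epi_g
  exact ⟨h.exact.desc k hk, h.exact.g_desc k hk⟩

/-- There is a short exact sequence `0 → X → Y → Z → 0`. -/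
def HasSES (X Y Z : C) : Prop := ∃ (f : X ⟶ Y) (g : Y ⟶ Z), IsSES f g

lemma IsSES.of_isPushout {A A' B B' D : C} {i : A ⟶ B} {p : B ⟶ D} (h : IsSES i p)
    {f : A ⟶ A'} {i' : A' ⟶ B'} {f' : B ⟶ B'} (sq : IsPushout f i i' f') :
    ∃ p' : B' ⟶ D, IsSES i' p' := by
  have := h.mono
  have := h.epi
  have : Mono i' := Abelian.mono_inl_of_isColimit f i sq.isColimit
  have w : f ≫ (0 : A' ⟶ D) = i ≫ p := by simp [h.choose]
  have : Epi (sq.desc 0 p w) := epi_of_epi_fac (sq.inr_desc 0 p w)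
  refine ⟨sq.desc 0 p w, isSES_of_desc _ _ (sq.inl_desc 0 p w) fun T k hk => ?_⟩
  obtain ⟨l, hl⟩ := h.exists_desc (f' ≫ k) (by rw [← sq.w_assoc, hk, comp_zero])
  exact ⟨l, sq.hom_ext (by simp [hk]) (by simp [hl])⟩

lemma HasSES.pushout_mono {A A' B D E : C} (h : HasSES A B D) (h' : HasSES A A' E) :
    ∃ B', HasSES A' B' D ∧ HasSES B B' E := by
  obtain ⟨i, p, h⟩ := h
  obtain ⟨f, q, h'⟩ := h'
  have sq := IsPushout.of_hasPushout f i
  exact ⟨_, ⟨_, h.of_isPushout sq⟩, ⟨_, h'.of_isPushout sq.flip⟩⟩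

lemma HasSES.pushout_epi {A A' B D K : C} (h : HasSES A B D) (h' : HasSES K A A') :
    ∃ B', HasSES A' B' D ∧ HasSES K B B' := by
  obtain ⟨i, p, h⟩ := h
  obtain ⟨k, f, h'⟩ := h'
  have sq := IsPushout.of_hasPushout f i
  have := h.mono
  have := h'.mono
  have := h'.epi
  refine ⟨_, ⟨_, h.of_isPushout sq⟩, k ≫ i, pushout.inr f i, ?_⟩
  have : Epi (pushout.inr f i) := inferInstance
  refine isSES_of_desc _ _ ?_ fun T t ht => ?_
  · rw [Category.assoc, ← sq.w, ← Category.assoc, h'.choose, zero_comp]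
  · obtain ⟨l, hl⟩ := h'.exists_desc (i ≫ t) (by rw [← Category.assoc, ht])
    exact ⟨pushout.desc l t hl, pushout.inr_desc _ _ _⟩

lemma hasSES_of_iso {X Y : C} (e : X ≅ Y) : HasSES (0 : C) X Y :=
  ⟨0, e.hom, isSES_of_desc _ _ zero_comp fun _ k _ => ⟨e.inv ≫ k, by simp⟩⟩

lemma HasSES.of_iso_left {X X' Y Z : C} (h : HasSES X' Y Z) (e : X ≅ X') : HasSES X Y Z := by
  obtain ⟨f, g, h⟩ := h
  have := h.mono
  have := h.epi
  refine ⟨e.hom ≫ f, g, isSES_of_desc _ _ (by simp [h.choose]) fun T k hk => h.exists_desc k ?_⟩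
  rwa [Category.assoc, Preadditive.IsIso.comp_left_eq_zero] at hk

lemma exists_hasSES_projective [EnoughProjectives C] (X : C) :
    ∃ K P, Projective P ∧ HasSES K P X := by
  refine ⟨kernel (Projective.π X), Projective.over X, inferInstance, kernel.ι _, Projective.π X,
    kernel.condition _, ⟨ShortComplex.exact_kernel _⟩⟩

lemma HasSES.projective {X Y Z : C} (h : HasSES X Y Z) (hX : Projective X) (hZ : Projective Z) :
    Projective Y := by
  obtain ⟨f, g, w, h⟩ := h
  rw [projective_iff_hasProjectiveDimensionLT_one] at *
  exact h.hasProjectiveDimensionLT_X₂ 1 hX hZ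

section Ext

variable [HasExt.{w} C]

lemma IsSES.exists_section {X Y Z : C} {f : X ⟶ Y} {g : Y ⟶ Z} (h : IsSES f g)
    (hZ : Subsingleton (Ext Z X 1)) : ∃ s : Z ⟶ Y, s ≫ g = 𝟙 Z := by
  obtain ⟨w, h⟩ := h
  obtain ⟨x, hx⟩ := Ext.covariant_sequence_exact₃ Z h (Ext.mk₀ (𝟙 Z)) (zero_add 1)
    (Subsingleton.elim _ _)
  obtain ⟨s, rfl⟩ := (Ext.mk₀_bijective _ _).2 x
  exact ⟨s, (Ext.mk₀_bijective _ _).1 (by simpa using hx)⟩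

lemma IsSES.exists_extension {X Y Z T : C} {f : X ⟶ Y} {g : Y ⟶ Z} (h : IsSES f g)
    (hZ : Subsingleton (Ext Z T 1)) (t : X ⟶ T) : ∃ s : Y ⟶ T, f ≫ s = t := by
  obtain ⟨w, h⟩ := h
  obtain ⟨x, hx⟩ := Ext.contravariant_sequence_exact₁ h T (Ext.mk₀ t) (add_zero 1)
    (Subsingleton.elim _ _)
  obtain ⟨s, rfl⟩ := (Ext.mk₀_bijective _ _).2 x
  exact ⟨s, (Ext.mk₀_bijective _ _).1 (by simpa using hx)⟩

lemma IsSES.subsingleton_ext_one {X Y Z T : C} {f : X ⟶ Y} {g : Y ⟶ Z} (h : IsSES f g)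
    (hY : Subsingleton (Ext Y T 1)) (hex : ∀ t : X ⟶ T, ∃ s : Y ⟶ T, f ≫ s = t) :
    Subsingleton (Ext Z T 1) := by
  obtain ⟨w, h⟩ := h
  refine subsingleton_of_forall_eq 0 fun x => ?_
  obtain ⟨y, rfl⟩ := Ext.contravariant_sequence_exact₃ h T x (Subsingleton.elim _ _) (add_zero 1)
  obtain ⟨t, rfl⟩ := (Ext.mk₀_bijective _ _).2 y
  obtain ⟨s, rfl⟩ := hex t
  rw [← Ext.mk₀_comp_mk₀]
  exact h.extClass_comp_assoc (Ext.mk₀ s)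

lemma HasSES.swap {X Y Z : C} (h : HasSES X Y Z) (hZ : Subsingleton (Ext Z X 1)) :
    HasSES Z Y X := by
  obtain ⟨f, g, h⟩ := h
  obtain ⟨s, hs⟩ := h.exists_section hZ
  obtain ⟨w, h⟩ := h
  let σ := ShortComplex.Splitting.ofExactOfSection _ h.exact s hs h.mono_f
  exact ⟨σ.s, σ.r, σ.s_r, ShortComplex.Splitting.shortExact
    { r := g, s := f, f_r := σ.s_g, s_g := σ.f_r, id := by rw [add_comm]; exact σ.id }⟩

lemma HasSES.retract {X Y Z : C} (h : HasSES X Y Z) (hZ : Subsingleton (Ext Z X 1)) :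
    Nonempty (Retract Z Y) := by
  obtain ⟨f, g, h⟩ := h
  obtain ⟨s, hs⟩ := h.exists_section hZ
  exact ⟨⟨s, g, hs⟩⟩

lemma HasSES.subsingleton_ext₂ {X Y Z : C} (h : HasSES X Y Z) {T : C} {n : ℕ}
    (hX : Subsingleton (Ext X T n)) (hZ : Subsingleton (Ext Z T n)) :
    Subsingleton (Ext Y T n) := by
  obtain ⟨f, g, w, h⟩ := h
  refine subsingleton_of_forall_eq 0 fun x => ?_
  obtain ⟨y, rfl⟩ := Ext.contravariant_sequence_exact₂ h T x (Subsingleton.elim _ _)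
  rw [Subsingleton.elim y 0, Ext.comp_zero]

lemma HasSES.subsingleton_ext₁ {X Y Z : C} (h : HasSES X Y Z) {T : C} {n : ℕ}
    (hY : Subsingleton (Ext Y T n)) (hZ : Subsingleton (Ext Z T (n + 1))) :
    Subsingleton (Ext X T n) := by
  obtain ⟨f, g, w, h⟩ := h
  refine subsingleton_of_forall_eq 0 fun x => ?_
  obtain ⟨y, rfl⟩ := Ext.contravariant_sequence_exact₁ h T x (add_comm 1 n)
    (Subsingleton.elim _ _)
  rw [Subsingleton.elim y 0, Ext.comp_zero]

lemma HasSES.subsingleton_ext₃ {X Y Z : C} (h : HasSES X Y Z) {T : C} {n : ℕ}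
    (hX : Subsingleton (Ext X T n)) (hY : Subsingleton (Ext Y T (n + 1))) :
    Subsingleton (Ext Z T (n + 1)) := by
  obtain ⟨f, g, w, h⟩ := h
  refine subsingleton_of_forall_eq 0 fun x => ?_
  obtain ⟨y, rfl⟩ := Ext.contravariant_sequence_exact₃ h T x (Subsingleton.elim _ _)
    (add_comm 1 n)
  rw [Subsingleton.elim y 0, Ext.comp_zero]

lemma HasSES.subsingleton_ext_right {X Y Z : C} (h : HasSES X Y Z) {T : C} {n : ℕ}
    (hY : Subsingleton (Ext T Y n)) (hX : Subsingleton (Ext T X (n + 1))) :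
    Subsingleton (Ext T Z n) := by
  obtain ⟨f, g, w, h⟩ := h
  refine subsingleton_of_forall_eq 0 fun x => ?_
  obtain ⟨y, rfl⟩ := Ext.covariant_sequence_exact₃ T h x rfl (Subsingleton.elim _ _)
  rw [Subsingleton.elim y 0, Ext.zero_comp]

end Ext

end ShortExact

section FiniteProjectiveDimension

variable {C : Type u} [Category.{v} C] [Abelian C]

lemma projDim_ne_top_iff [HasExt.{w} C] {X : C} :
    projDim X ≠ ⊤ ↔ ∃ n, HasProjectiveDimensionLT X n := by
  constructor
  · intro h
    have hne : {n : ℕ∞ | ∃ m : ℕ, n = (m : ℕ∞) ∧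
        ∀ (Y : C) (j : ℕ), m < j → Subsingleton (Abelian.Ext X Y j)}.Nonempty := by
      rw [Set.nonempty_iff_ne_empty]
      intro he
      exact h (by rw [projDim, he, sInf_empty])
    obtain ⟨_, m, -, hm⟩ := hne
    refine ⟨m + 1, HasProjectiveDimensionLT.mk fun i hi Y e => ?_⟩
    have := hm Y i hi
    exact Subsingleton.elim _ _
  · rintro ⟨n, hn⟩
    refine ne_top_of_le_ne_top (ENat.natCast_ne_top n) (sInf_le ⟨n, rfl, fun Y j hj => ?_⟩)
    exact hn.subsingleton X n j hj.le Y

lemma HasSES.exists_hasProjectiveDimensionLT {X Y Z : C} (h : HasSES X Y Z)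
    (hX : ∃ n, HasProjectiveDimensionLT X n) (hY : Projective Y) :
    ∃ n, HasProjectiveDimensionLT Z n := by
  obtain ⟨n, hX⟩ := hX
  obtain ⟨f, g, w, h⟩ := h
  have h1 : HasProjectiveDimensionLT X (n + 1) :=
    hasProjectiveDimensionLT_of_ge X n (n + 1) n.le_succ
  exact ⟨n + 2, (h.hasProjectiveDimensionLT_X₃_iff n hY).2 h1⟩

/-- Objects all of whose higher extensions into projective objects vanish also have vanishing
higher extensions into objects of finite projective dimension. -/
lemma subsingleton_ext_of_hasProjectiveDimensionLT [EnoughProjectives C] [HasExt.{w} C] {X : C}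
    (hX : ∀ Q : C, Projective Q → ∀ j, 0 < j → Subsingleton (Ext X Q j)) (n : ℕ) :
    ∀ K : C, HasProjectiveDimensionLT K n → ∀ j, 0 < j → Subsingleton (Ext X K j) := by
  have base (K : C) (hK : HasProjectiveDimensionLT K 1) (j : ℕ) (hj : 0 < j) :
      Subsingleton (Ext X K j) :=
    hX K (projective_iff_hasProjectiveDimensionLT_one.2 hK) j hj
  induction n with
  | zero => exact fun K hK => base K (hasProjectiveDimensionLT_of_ge K 0 1 zero_le_one)
  | succ n ih =>
    obtain _ | n := n
    · exact base
    intro K hK j hj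
    obtain ⟨K', P, hP, f, g, w, h⟩ := exists_hasSES_projective K
    have hK' := (h.hasProjectiveDimensionLT_X₃_iff n hP).1 hK
    exact HasSES.subsingleton_ext_right ⟨f, g, w, h⟩ (hX P hP j hj) (ih K' hK' _ j.succ_pos)

end FiniteProjectiveDimension

section Syzygies

variable {C : Type u} [Category.{v} C] [Abelian C]

lemma isSES_cokernel {P : ChainComplex C ℤ} (hP : IsTotallyAcyclic P) (k : ℤ) :
    IsSES (cokernel.desc (P.d (k + 1 + 1) (k + 1)) (P.d (k + 1) k) (P.d_comp_d _ _ _))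
      (cokernel.π (P.d (k + 1) k)) := by
  have hex : (P.sc' (k + 1 + 1) (k + 1) k).Exact :=
    (P.exactAt_iff' _ _ _ (by simp) (by simp)).1 (hP.acyclic (k + 1))
  have : Mono (cokernel.desc (P.d (k + 1 + 1) (k + 1)) (P.d (k + 1) k) (P.d_comp_d _ _ _)) :=
    (ShortComplex.exact_iff_mono_cokernel_desc _).1 hex
  refine isSES_of_desc _ _ ?_ fun T t ht => ?_
  · rw [← cancel_epi (cokernel.π _)]
    simp
  · refine ⟨cokernel.desc _ t ?_, cokernel.π_desc _ _ _⟩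
    rw [← cokernel.π_desc (P.d (k + 1 + 1) (k + 1)) (P.d (k + 1) k) (P.d_comp_d _ _ _),
      Category.assoc, ht, comp_zero]

variable [HasExt.{w} C]

/-- A class of objects with no higher extensions into projective objects, each of which embeds
into a projective object with cokernel in the class. -/
structure IsCosyzygyClosed (S : C → Prop) : Prop where
  ext : ∀ X, S X → ∀ Q : C, Projective Q → ∀ j, 0 < j → Subsingleton (Ext X Q j)
  coresolve : ∀ X, S X → ∃ P Y, Projective P ∧ HasSES X P Y ∧ S Y

lemma subsingleton_ext_cokernel {P : ChainComplex C ℤ} (hP : IsTotallyAcyclic P) {Q : C}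
    (hQ : Projective Q) (j : ℕ) :
    ∀ k : ℤ, Subsingleton (Ext (cokernel (P.d (k + 1) k)) Q (j + 1)) := by
  have hX (k : ℤ) (j : ℕ) : Subsingleton (Ext (P.X k) Q (j + 1)) :=
    have := hP.projective k
    Ext.subsingleton_of_projective _ _ _
  induction j with
  | zero =>
    intro k
    refine (isSES_cokernel hP k).subsingleton_ext_one (hX k 0) fun t => ?_
    have key := hP.homExact Q hQ (k + 1) (cokernel.π _ ≫ t) (by simp)
    rw [add_sub_cancel_right] at key
    obtain ⟨s, hs⟩ := key
    refine ⟨s, ?_⟩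
    rw [← cancel_epi (cokernel.π _), cokernel.π_desc_assoc, hs]
  | succ j ih => exact fun k => HasSES.subsingleton_ext₃ ⟨_, _, isSES_cokernel hP k⟩ (ih _) (hX _ _)

lemma isCosyzygyClosed_cokernel :
    IsCosyzygyClosed fun X : C => ∃ P : ChainComplex C ℤ, IsTotallyAcyclic P ∧
      ∃ k : ℤ, Nonempty (X ≅ cokernel (P.d (k + 1) k)) where
  ext := by
    rintro X ⟨P, hP, k, ⟨e⟩⟩ Q hQ (_ | j) hj
    · simp at hj
    · exact (hasSES_of_iso e).subsingleton_ext₂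
        (HasProjectiveDimensionLT.subsingleton 0 0 _ (Nat.zero_le _) _)
        (subsingleton_ext_cokernel hP hQ j k)
  coresolve := by
    rintro X ⟨P, hP, k, ⟨e⟩⟩
    obtain ⟨k, rfl⟩ : ∃ m, k = m + 1 := ⟨k - 1, by simp⟩
    exact ⟨P.X k, _, hP.projective k, HasSES.of_iso_left ⟨_, _, isSES_cokernel hP k⟩ e,
      P, hP, k, ⟨Iso.refl _⟩⟩

lemma isGorensteinProjective_of_syzygies {Z : ℤ → C}
    (hZ : ∀ i, ∃ P, Projective P ∧ HasSES (Z (i + 1)) P (Z i))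
    (hext : ∀ i Q, Projective Q → Subsingleton (Ext (Z i) Q 1)) :
    IsGorensteinProjective (Z 0) := by
  choose P hP f g h using hZ
  have w (i : ℤ) : f i ≫ g i = 0 := (h i).choose
  have hf (i : ℤ) := (h i).mono
  have hg (i : ℤ) := (h i).epi
  have sq (i : ℤ) : (g (i + 1 + 1) ≫ f (i + 1)) ≫ g (i + 1) ≫ f i = 0 := by
    rw [Category.assoc, reassoc_of% w (i + 1), zero_comp, comp_zero]
  let D : ChainComplex C ℤ := ChainComplex.of P (fun i => g (i + 1) ≫ f i) sq
  have hd (i : ℤ) : D.d (i + 1) i = g (i + 1) ≫ f i :=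
    ChainComplex.of_d P (fun i => g (i + 1) ≫ f i) i
  refine ⟨D, ⟨hP, fun i => ?_, fun Q hQ i t ht => ?_⟩, ?_⟩
  · obtain ⟨i, rfl⟩ : ∃ m, i = m + 1 := ⟨i - 1, by simp⟩
    rw [D.exactAt_iff' (i + 1 + 1) (i + 1) i (by simp) (by simp)]
    have h₁ : (ShortComplex.mk (f (i + 1)) (g (i + 1)) (w _)).Exact :=
      (h (i + 1)).choose_spec.exact
    let φ : ShortComplex.mk (f (i + 1)) (g (i + 1)) (w _) ⟶
        ShortComplex.mk (f (i + 1)) (g (i + 1) ≫ f i) (by simp [reassoc_of% w]) :=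
      { τ₁ := 𝟙 _, τ₂ := 𝟙 _, τ₃ := f i }
    let ψ : D.sc' (i + 1 + 1) (i + 1) i ⟶
        ShortComplex.mk (f (i + 1)) (g (i + 1) ≫ f i) (by simp [reassoc_of% w]) :=
      { τ₁ := g _
        τ₂ := 𝟙 _
        τ₃ := 𝟙 _
        comm₁₂ := (hd _).symm.trans (Category.comp_id _).symm
        comm₂₃ := (Category.id_comp _).trans ((hd _).symm.trans (Category.comp_id _).symm) }
    have : Epi φ.τ₁ := inferInstanceAs (Epi (𝟙 _))
    have : IsIso φ.τ₂ := inferInstanceAs (IsIso (𝟙 _))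
    have : Mono φ.τ₃ := hf i
    have : Epi ψ.τ₁ := hg _
    have : IsIso ψ.τ₂ := inferInstanceAs (IsIso (𝟙 _))
    have : Mono ψ.τ₃ := inferInstanceAs (Mono (𝟙 _))
    rw [ShortComplex.exact_iff_of_epi_of_isIso_of_mono ψ,
      ← ShortComplex.exact_iff_of_epi_of_isIso_of_mono φ]
    exact h₁
  · obtain ⟨i, rfl⟩ : ∃ m, i = m + 1 := ⟨i - 1, by simp⟩
    rw [add_sub_cancel_right]
    rw [hd, Category.assoc] at ht
    obtain ⟨l, hl⟩ := (h (i + 1)).exists_desc t (zero_of_epi_comp _ ht)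
    obtain ⟨s, hs⟩ := (h i).exists_extension (hext i Q hQ) l
    exact ⟨s, by rw [hd, Category.assoc, hs, hl]⟩
  · have e : cokernel (D.d (0 + 1) 0) ≅ cokernel (f 0) :=
      cokernelIsoOfEq (hd 0) ≪≫ cokernelEpiComp _ _
    exact ⟨(IsColimit.coconePointUniqueUpToIso (h 0).choose_spec.gIsCokernel
      (cokernelIsCokernel _)) ≪≫ e.symm⟩

variable [EnoughProjectives C]

lemma IsCosyzygyClosed.isGorensteinProjective {S : C → Prop} (hS : IsCosyzygyClosed S) {X : C}
    (hX : S X) : IsGorensteinProjective X := by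
  choose P Y hP hY hSY using hS.coresolve
  choose K R hR hK using exists_hasSES_projective (C := C)
  let cosyz : ℕ → Subtype S := fun n => (fun y => ⟨_, hSY y.1 y.2⟩)^[n] ⟨X, hX⟩
  have hcosyz (n : ℕ) :
      ∃ P, Projective P ∧ HasSES (cosyz n).1 P (cosyz (n + 1)).1 := by
    simp only [cosyz, Function.iterate_succ_apply']
    exact ⟨_, hP _ _, hY _ _⟩
  let syz : ℕ → C := fun n => K^[n] X
  have hsyz (n : ℕ) : ∃ P, Projective P ∧ HasSES (syz (n + 1)) P (syz n) := by
    simp only [syz, Function.iterate_succ_apply']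
    exact ⟨_, hR _, hK _⟩
  have hsyz_ext (n : ℕ) (Q : C) (hQ : Projective Q) :
      ∀ j, 0 < j → Subsingleton (Ext (syz n) Q j) := by
    induction n with
    | zero => exact hS.ext X hX Q hQ
    | succ n ih =>
      intro j hj
      obtain ⟨P, hP, h⟩ := hsyz n
      obtain ⟨j, rfl⟩ := Nat.exists_eq_succ_of_ne_zero hj.ne'
      exact h.subsingleton_ext₁ (Ext.subsingleton_of_projective _ _ _) (ih _ (Nat.succ_pos _))
  let Z : ℤ → C := fun i => Int.rec syz (fun n => (cosyz (n + 1)).1) i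
  refine isGorensteinProjective_of_syzygies (Z := Z) ?_ ?_
  · rintro (n | _ | n)
    · exact hsyz n
    · exact hcosyz 0
    · exact hcosyz (n + 1)
  · rintro (n | n) Q hQ
    · exact hsyz_ext n Q hQ 1 one_pos
    · exact hS.ext _ (cosyz (n + 1)).2 Q hQ 1 one_pos

lemma isCosyzygyClosed_isGorensteinProjective :
    IsCosyzygyClosed (IsGorensteinProjective (C := C)) where
  ext := fun X ⟨P, hP, e⟩ => isCosyzygyClosed_cokernel.ext X ⟨P, hP, 0, e⟩
  coresolve := fun X ⟨P, hP, e⟩ =>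
    have ⟨R, Y, hR, hY, hS⟩ := isCosyzygyClosed_cokernel.coresolve X ⟨P, hP, 0, e⟩
    ⟨R, Y, hR, hY, isCosyzygyClosed_cokernel.isGorensteinProjective hS⟩

lemma IsGorensteinProjective.subsingleton_ext {G K : C} (hG : IsGorensteinProjective G)
    (hK : ∃ n, HasProjectiveDimensionLT K n) {j : ℕ} (hj : 0 < j) :
    Subsingleton (Ext G K j) :=
  have ⟨n, hn⟩ := hK
  subsingleton_ext_of_hasProjectiveDimensionLT
    (isCosyzygyClosed_isGorensteinProjective.ext G hG) n K hn j hj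

variable (C) in
lemma isCosyzygyClosed_extension :
    IsCosyzygyClosed fun E : C => ∃ A B, IsGorensteinProjective A ∧ IsGorensteinProjective B ∧
      HasSES A E B where
  ext := fun _ ⟨A, B, hA, hB, h⟩ Q hQ j hj =>
    h.subsingleton_ext₂ (isCosyzygyClosed_isGorensteinProjective.ext A hA Q hQ j hj)
      (isCosyzygyClosed_isGorensteinProjective.ext B hB Q hQ j hj)
  coresolve := by
    rintro E ⟨A, B, hA, hB, h⟩
    obtain ⟨P, A', hP, hPA, hA'⟩ := isCosyzygyClosed_isGorensteinProjective.coresolve A hA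
    obtain ⟨Q, B', hQ, hQB, hB'⟩ := isCosyzygyClosed_isGorensteinProjective.coresolve B hB
    obtain ⟨E', h₁, h₂⟩ := h.pushout_mono hPA
    have h₃ := h₁.swap (isCosyzygyClosed_isGorensteinProjective.ext B hB P hP 1 one_pos)
    obtain ⟨F, h₄, h₅⟩ := h₃.pushout_mono hQB
    obtain ⟨H, h₆, h₇⟩ := h₅.pushout_epi h₂
    exact ⟨F, H, h₄.projective hQ hP, h₇, A', B', hA', hB', h₆⟩

lemma HasSES.isGorensteinProjective {A E B : C} (h : HasSES A E B)
    (hA : IsGorensteinProjective A) (hB : IsGorensteinProjective B) :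
    IsGorensteinProjective E :=
  (isCosyzygyClosed_extension C).isGorensteinProjective ⟨A, B, hA, hB, h⟩

/-- An approximation by a Gorenstein projective object with kernel of finite projective dimension
yields an embedding into an object of finite projective dimension with Gorenstein projective
cokernel. -/
lemma HasSES.exists_embedding {K G X : C} (h : HasSES K G X) (hG : IsGorensteinProjective G) :
    ∃ P Y G', Projective P ∧ HasSES K P Y ∧ HasSES X Y G' ∧ IsGorensteinProjective G' := by
  obtain ⟨P, G', hP, hGP, hG'⟩ := isCosyzygyClosed_isGorensteinProjective.coresolve G hG
  obtain ⟨Y, h₁, h₂⟩ := hGP.pushout_epi h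
  exact ⟨P, Y, G', hP, h₂, h₁, hG'⟩

lemma HasResDimLE.exists_approximation {X : C} {n : ℕ}
    (h : HasResDimLE IsGorensteinProjective X n) :
    ∃ K G, HasSES K G X ∧ IsGorensteinProjective G ∧ ∃ m, HasProjectiveDimensionLT K m := by
  induction h with
  | of_mem hX n => exact ⟨0, _, hasSES_of_iso (Iso.refl _), hX, 0, inferInstance⟩
  | step n f g hses hG _ ih =>
    obtain ⟨K₁, G₁, h₁, hG₁, hK₁⟩ := ih
    obtain ⟨P, Y, G', hP, h₂, h₃, hG'⟩ := h₁.exists_embedding hG₁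
    obtain ⟨E, h₄, h₅⟩ := h₃.pushout_mono ⟨f, g, hses⟩
    exact ⟨Y, E, h₅, h₄.isGorensteinProjective hG hG', h₂.exists_hasProjectiveDimensionLT hK₁ hP⟩

end Syzygies

end Lemmas

/-- In a naively Gorenstein category, `(gpC, pC⁻)` is a hereditary cotorsion
pair with enough projectives. -/
theorem gp_cotorsion_pair {C : Type u} [Category.{v} C] [Abelian C]
    [EnoughProjectives C] [HasExt.{w} C]
    (hGor : ∀ X : C, gDim X ≠ ⊤) :
    (∀ X : C, IsGorensteinProjective X ↔
        ∀ K : C, projDim K ≠ ⊤ → Subsingleton (Abelian.Ext X K 1)) ∧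
    (∀ K : C, projDim K ≠ ⊤ ↔
        ∀ G : C, IsGorensteinProjective G → Subsingleton (Abelian.Ext G K 1)) ∧
    (∀ (G K : C), IsGorensteinProjective G → projDim K ≠ ⊤ →
        ∀ j : ℕ, 0 < j → Subsingleton (Abelian.Ext G K j)) ∧
    (∀ X : C, ∃ (K G : C) (f : K ⟶ G) (g : G ⟶ X),
        IsSES f g ∧ IsGorensteinProjective G ∧
        ∀ B : C, IsGorensteinProjective B → Subsingleton (Abelian.Ext B K 1)) := by
  have happrox (X : C) : ∃ K G, HasSES K G X ∧ IsGorensteinProjective G ∧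
      ∃ m, HasProjectiveDimensionLT K m := by
    have hne : {n : ℕ∞ | ∃ m : ℕ, n = (m : ℕ∞) ∧
        HasResDimLE IsGorensteinProjective X m}.Nonempty := by
      rw [Set.nonempty_iff_ne_empty]
      intro he
      exact hGor X (by rw [gDim, he, sInf_empty])
    obtain ⟨_, m, -, hm⟩ := hne
    exact hm.exists_approximation
  simp only [projDim_ne_top_iff]
  refine ⟨fun X => ⟨fun hX K hK => hX.subsingleton_ext hK one_pos, fun hX => ?_⟩,
    fun K => ⟨fun hK G hG => hG.subsingleton_ext hK one_pos, fun hK => ?_⟩,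
    fun G K hG hK j hj => hG.subsingleton_ext hK hj, fun X => ?_⟩
  · let S : C → Prop := fun X => ∀ K : C, (∃ n, HasProjectiveDimensionLT K n) →
      Subsingleton (Abelian.Ext X K 1)
    have hS (X : C) (hX : S X) :
        ∃ P G', Projective P ∧ HasSES X P G' ∧ IsGorensteinProjective G' := by
      obtain ⟨K, G, h, hG, hK⟩ := happrox X
      obtain ⟨P, Y, G', hP, h₁, h₂, hG'⟩ := h.exists_embedding hG
      obtain ⟨r⟩ := h₁.retract (h₂.subsingleton_ext₂ (hX K hK) (hG'.subsingleton_ext hK one_pos))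
      exact ⟨Y, G', r.projective, h₂, hG'⟩
    refine IsCosyzygyClosed.isGorensteinProjective (S := S) ⟨fun X hX Q hQ j hj => ?_,
      fun X hX => ?_⟩ hX
    · obtain ⟨P, G', hP, h, hG'⟩ := hS X hX
      obtain ⟨j, rfl⟩ := Nat.exists_eq_succ_of_ne_zero hj.ne'
      exact h.subsingleton_ext₁ (Abelian.Ext.subsingleton_of_projective _ _ _)
        (isCosyzygyClosed_isGorensteinProjective.ext G' hG' Q hQ _ (Nat.succ_pos _))
    · obtain ⟨P, G', hP, h, hG'⟩ := hS X hX
      exact ⟨P, G', hP, h, fun K hK => hG'.subsingleton_ext hK one_pos⟩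
  · obtain ⟨K', G, h, hG, hK'⟩ := happrox K
    obtain ⟨P, Y, G', hP, h₁, ⟨f, g, h₂⟩, hG'⟩ := h.exists_embedding hG
    obtain ⟨n, hn⟩ := h₁.exists_hasProjectiveDimensionLT hK' hP
    obtain ⟨r, hr⟩ := h₂.exists_extension (hK G' hG') (𝟙 K)
    exact ⟨n, (Retract.mk f r hr).hasProjectiveDimensionLT n⟩
  · obtain ⟨K, G, ⟨f, g, h⟩, hG, hK⟩ := happrox X
    exact ⟨K, G, f, g, h, hG, fun B hB => hB.subsingleton_ext hK one_pos⟩
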